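/- Assume U₁₀ = U₀₀ = 0 and P_s(Ŷ=1) > 0 for s ∈ {0,1}. Write q_s := P_s(Ŷ=1), q₁(1,1) := P₁(Y=1 | Ŷ=1), and δ := P₀(Y=1 | Ŷ=1) − P₁(Y=1 | Ŷ=1). Then the utility difference satisfies UD = (U₁₁ − U₀₁)·(q₁(1,1)·(q₀ − q₁) + q₀·δ) + U₀₁·(q₀ − q₁). -/

import Mathlib

open MeasureTheory

lemma integral_utility_aux {Ω : Type*} [MeasurableSpace Ω]
    (P : Measure Ω) [IsProbabilityMeasure P]
    (Y Yhat : Ω → Bool) (hY : Measurable Y) (hYhat : Measurable Yhat) (a b : ℝ)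
    (U : Ω → ℝ)
    (hU : ∀ ω, U ω = if Y ω then (if Yhat ω then b else 0)
                     else (if Yhat ω then a else 0)) :
    ∫ ω, U ω ∂P = (b - a) * (P {ω | Y ω = true ∧ Yhat ω = true}).toReal
      + a * (P {ω | Yhat ω = true}).toReal := by
  have hB : MeasurableSet {ω | Yhat ω = true} := hYhat (measurableSet_singleton true)
  have hA : MeasurableSet {ω | Y ω = true ∧ Yhat ω = true} :=
    (hY (measurableSet_singleton true)).inter hB
  have h : U = fun ω => {ω | Y ω = true ∧ Yhat ω = true}.indicator (fun _ => b - a) ω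
      + {ω | Yhat ω = true}.indicator (fun _ => a) ω := by
    funext ω
    rw [hU]
    cases h1 : Y ω <;> cases h2 : Yhat ω <;> simp [Set.indicator, h1, h2]
  rw [h, integral_add ((integrable_const _).indicator hA) ((integrable_const _).indicator hB),
    integral_indicator_const _ hA, integral_indicator_const _ hB]
  simp only [Measure.real, smul_eq_mul]
  ring

/-- Assume `U₁₀ = U₀₀ = 0` and `P_s(Ŷ=1) > 0` for `s ∈ {0,1}`. With
`q_s := P_s(Ŷ=1)`, `q₁(1,1) := P₁(Y=1 | Ŷ=1)` and
`δ := P₀(Y=1 | Ŷ=1) − P₁(Y=1 | Ŷ=1)`, the utility difference satisfies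
`UD = (U₁₁ − U₀₁)·(q₁(1,1)·(q₀ − q₁) + q₀·δ) + U₀₁·(q₀ − q₁)`.
Here `true` encodes the value `1` and `false` the value `0`, and `Yhat` is the prediction `Ŷ`;
the conditional probability `P(A|B)` is written as `P(A ∩ B)/P(B)`. -/
theorem college_admission_utility_difference {Ω : Type*} [MeasurableSpace Ω]
    (P₀ P₁ : Measure Ω) [IsProbabilityMeasure P₀] [IsProbabilityMeasure P₁]
    (Y Yhat : Ω → Bool) (hY : Measurable Y) (hYhat : Measurable Yhat)
    (U₀₀ U₀₁ U₁₀ U₁₁ : ℝ) (hU10 : U₁₀ = 0) (hU00 : U₀₀ = 0)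
    (U : Ω → ℝ)
    (hU : ∀ ω, U ω = if Y ω then (if Yhat ω then U₁₁ else U₁₀)
                     else (if Yhat ω then U₀₁ else U₀₀))
    (UD : ℝ) (hUD : UD = (∫ ω, U ω ∂P₀) - ∫ ω, U ω ∂P₁)
    (hpos : 0 < (P₀ {ω | Yhat ω = true}).toReal ∧ 0 < (P₁ {ω | Yhat ω = true}).toReal)
    (q₀ q₁ q₁11 δ : ℝ)
    (hq₀ : q₀ = (P₀ {ω | Yhat ω = true}).toReal)
    (hq₁ : q₁ = (P₁ {ω | Yhat ω = true}).toReal)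
    (hq₁11 : q₁11 = (P₁ {ω | Y ω = true ∧ Yhat ω = true}).toReal
        / (P₁ {ω | Yhat ω = true}).toReal)
    (hδ : δ = (P₀ {ω | Y ω = true ∧ Yhat ω = true}).toReal
        / (P₀ {ω | Yhat ω = true}).toReal - q₁11) :
    UD = (U₁₁ - U₀₁) * (q₁11 * (q₀ - q₁) + q₀ * δ) + U₀₁ * (q₀ - q₁) := by
  subst hU10 hU00
  obtain ⟨h0, h1⟩ := hpos
  rw [hUD, integral_utility_aux P₀ Y Yhat hY hYhat U₀₁ U₁₁ U hU,
    integral_utility_aux P₁ Y Yhat hY hYhat U₀₁ U₁₁ U hU, hδ, hq₁11, hq₀, hq₁]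
  field_simp
  ring
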